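/- Suppose F has characteristic p ≥ 5, let q be a power of p, and let t_1 ∈ F^× have multiplicative order q + 1. Set t = diag(t_1, 1, t_1^{-1}) and let h be the corresponding endomorphism of sl_3(F). Then h has simple spectrum on sl_3(F), i.e., h has eight pairwise distinct eigenvalues. -/

import Mathlib

noncomputable section

/-- `sl₃(F)`: the space of traceless `3 × 3` matrices over `F`. -/
def sl3 (F : Type*) [Field F] : Submodule F (Matrix (Fin 3) (Fin 3) F) :=
  LinearMap.ker (Matrix.traceLinearMap (Fin 3) F F)

/-- The matrix `n_w` with rows `(0,1,0)`, `(1,0,0)`, `(0,0,-1)`. -/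
def nw (F : Type*) [Field F] : Matrix (Fin 3) (Fin 3) F :=
  !![0, 1, 0; 1, 0, 0; 0, 0, -1]

/-- The endomorphism `X ↦ -((n_w t) X (n_w t)⁻¹)ᵀ` of the space of `3 × 3` matrices,
where `t = diag(t₁, t₂, t₃)`. -/
def hFull (F : Type*) [Field F] (t₁ t₂ t₃ : F) :
    Module.End F (Matrix (Fin 3) (Fin 3) F) :=
  -((Matrix.transposeLinearEquiv (Fin 3) (Fin 3) F F).toLinearMap
      ∘ₗ LinearMap.mulRight F (nw F * Matrix.diagonal ![t₁, t₂, t₃])⁻¹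
      ∘ₗ LinearMap.mulLeft F (nw F * Matrix.diagonal ![t₁, t₂, t₃]))

/-- A diagonalizable endomorphism has *simple spectrum* if it is diagonalizable and every
eigenvalue has (geometric) multiplicity 1. -/
def HasSimpleSpectrum {F V : Type*} [Field F] [AddCommGroup V] [Module F V]
    (f : Module.End F V) : Prop :=
  (⨆ μ : F, f.eigenspace μ) = ⊤ ∧ ∀ μ : F, Module.finrank F (f.eigenspace μ) ≤ 1

theorem hasSimpleSpectrum_of_injective_eigenvalues {F V : Type*} [Field F] [AddCommGroup V]
    [Module F V] [FiniteDimensional F V] {ι : Type*} [Fintype ι] [Nonempty ι]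
    (f : Module.End F V) (μ : ι → F) (v : ι → V) (hμ : Function.Injective μ)
    (hv : ∀ i, v i ≠ 0) (hfv : ∀ i, f (v i) = μ i • v i)
    (hcard : Fintype.card ι = Module.finrank F V) : HasSimpleSpectrum f := by
  have hli : LinearIndependent F v :=
    Module.End.eigenvectors_linearIndependent' f μ hμ v
      fun i => Module.End.hasEigenvector_iff.2 ⟨Module.End.mem_eigenspace_iff.2 (hfv i), hv i⟩
  let b := basisOfLinearIndependentOfCardEqFinrank hli hcard
  have hb : ∀ i, b i = v i := fun i => by simp [b]
  refine ⟨?_, fun ν => ?_⟩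
  · rw [eq_top_iff, ← b.span_eq, Submodule.span_le]
    rintro _ ⟨i, rfl⟩
    refine Submodule.mem_iSup_of_mem (μ i) ?_
    rw [hb]
    exact Module.End.mem_eigenspace_iff.2 (hfv i)
  · have hrepr : ∀ x ∈ f.eigenspace ν, ∀ i, μ i ≠ ν → b.repr x i = 0 := by
      intro x hx i hi
      have hcomm : b.coord i ∘ₗ f = μ i • b.coord i := by
        refine b.ext fun j => ?_
        have hj : f (b j) = μ j • b j := by rw [hb, hfv]
        by_cases hij : j = i
        · subst hij
          simp [hj]
        · simp [hj, hij]
      have h := LinearMap.congr_fun hcomm x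
      rw [LinearMap.comp_apply, Module.End.mem_eigenspace_iff.1 hx] at h
      simp only [map_smul, LinearMap.smul_apply, Module.Basis.coord_apply, smul_eq_mul] at h
      have h' : (μ i - ν) * b.repr x i = 0 := by rw [sub_mul, h, sub_self]
      exact (mul_eq_zero.1 h').resolve_left (sub_ne_zero.2 hi)
    by_cases hν : ∃ i, μ i = ν
    · obtain ⟨i, rfl⟩ := hν
      refine finrank_le_one
        (⟨v i, Module.End.mem_eigenspace_iff.2 (hfv i)⟩ : f.eigenspace (μ i)) fun x => ?_
      refine ⟨b.repr x i, Subtype.ext ?_⟩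
      conv_rhs => rw [← b.sum_repr x]
      rw [Finset.sum_eq_single i, hb]
      · rfl
      · intro j _ hj
        rw [hrepr x x.2 j (hμ.ne hj), zero_smul]
      · simp
    · push Not at hν
      refine finrank_le_one 0 fun x => ⟨0, ?_⟩
      rw [zero_smul]
      refine Subtype.ext (b.ext_elem fun i => ?_)
      simp [hrepr x x.2 i (hν i)]

theorem finrank_sl3 (F : Type*) [Field F] : Module.finrank F (sl3 F) = 8 := by
  have h := LinearMap.finrank_range_add_finrank_ker (Matrix.traceLinearMap (Fin 3) F F)
  have hr : LinearMap.range (Matrix.traceLinearMap (Fin 3) F F) = ⊤ :=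
    LinearMap.range_eq_top.2 fun x => ⟨Matrix.single 0 0 x, by simp⟩
  rw [hr, finrank_top, Module.finrank_self, Module.finrank_matrix, Module.finrank_self] at h
  simp only [Fintype.card_fin] at h
  unfold sl3
  omega

theorem nw_mul_diagonal {F : Type*} [Field F] (a b c : F) :
    nw F * Matrix.diagonal ![a, b, c] = !![0, b, 0; a, 0, 0; 0, 0, -c] := by
  ext i j
  rw [Matrix.mul_diagonal]
  fin_cases i <;> fin_cases j <;> simp [nw]

theorem hFull_apply_eq_smul {F : Type*} [Field F] {a μ : F} (ha : a ≠ 0)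
    {X : Matrix (Fin 3) (Fin 3) F}
    (h : nw F * Matrix.diagonal ![a, 1, a⁻¹] * X =
      -(μ • (X.transpose * (nw F * Matrix.diagonal ![a, 1, a⁻¹])))) :
    hFull F a 1 a⁻¹ X = μ • X := by
  have hdet : IsUnit (nw F * Matrix.diagonal ![a, 1, a⁻¹]).det := by
    rw [Matrix.det_mul, Matrix.det_diagonal]
    simp [nw, Matrix.det_fin_three, Fin.prod_univ_three, ha]
  have e : hFull F a 1 a⁻¹ X = -((nw F * Matrix.diagonal ![a, 1, a⁻¹]) * X *
      (nw F * Matrix.diagonal ![a, 1, a⁻¹])⁻¹).transpose := rfl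
  rw [e, h, Matrix.neg_mul, Matrix.smul_mul, Matrix.mul_nonsing_inv_cancel_right _ _ hdet]
  simp

/-- The eigenvalues of `h` on `sl₃(F)` for `t = diag(s², 1, s⁻²)`. -/
def hEigenvalue {F : Type*} [Field F] (s : F) : Fin 8 → F :=
  ![1, -1, -s ^ 2, -(s ^ 2)⁻¹, s, -s, s⁻¹, -s⁻¹]

/-- Eigenvectors of `h` on `sl₃(F)` for the eigenvalues `hEigenvalue s`. -/
def hEigenvector {F : Type*} [Field F] (s : F) : Fin 8 → Matrix (Fin 3) (Fin 3) F :=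
  ![!![1, 0, 0; 0, -1, 0; 0, 0, 0],
    !![1, 0, 0; 0, 1, 0; 0, 0, -2],
    !![0, 1, 0; 0, 0, 0; 0, 0, 0],
    !![0, 0, 0; 1, 0, 0; 0, 0, 0],
    !![0, 0, 1; 0, 0, 0; 0, s ^ 3, 0],
    !![0, 0, 1; 0, 0, 0; 0, -s ^ 3, 0],
    !![0, 0, 0; 0, 0, 1; s ^ 3, 0, 0],
    !![0, 0, 0; 0, 0, 1; -s ^ 3, 0, 0]]

theorem hEigenvector_mem_sl3 {F : Type*} [Field F] (s : F) (i : Fin 8) :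
    hEigenvector s i ∈ sl3 F := by
  rw [sl3, LinearMap.mem_ker, Matrix.traceLinearMap_apply, Matrix.trace_fin_three]
  fin_cases i <;> simp [hEigenvector, one_add_one_eq_two]

theorem hEigenvector_ne_zero {F : Type*} [Field F] (s : F) (i : Fin 8) :
    hEigenvector s i ≠ 0 := by
  intro h
  have h' := fun j k => congrFun (congrFun h j) k
  fin_cases i <;> simp [hEigenvector, Fin.forall_fin_succ] at h'

theorem hFull_hEigenvector {F : Type*} [Field F] {s : F} (hs : s ≠ 0) (i : Fin 8) :
    hFull F (s ^ 2) 1 (s ^ 2)⁻¹ (hEigenvector s i) = hEigenvalue s i • hEigenvector s i := by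
  refine hFull_apply_eq_smul (pow_ne_zero 2 hs) ?_
  rw [nw_mul_diagonal]
  fin_cases i <;> ext j k <;> fin_cases j <;> fin_cases k <;>
    simp [hEigenvector, hEigenvalue, Matrix.mul_apply, Fin.sum_univ_three] <;> field_simp

theorem hEigenvalue_injective {F : Type*} [Field F] {s : F} (hs : s ≠ 0) (h2 : (2 : F) ≠ 0)
    (h4 : (s ^ 2) ^ 2 ≠ 1) (h6 : (s ^ 2) ^ 3 ≠ 1) :
    Function.Injective (hEigenvalue s) := by
  have hsi : s * s⁻¹ = 1 := mul_inv_cancel₀ hs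
  have hsi2 : (s ^ 2)⁻¹ = s⁻¹ ^ 2 := (inv_pow s 2).symm
  have key : ∀ i j : Fin 8, i < j → hEigenvalue s i ≠ hEigenvalue s j := by
    intro i j hij h
    fin_cases i <;> fin_cases j <;> first
      | exact absurd hij (by decide)
      | (simp [hEigenvalue] at h; grind)
  intro i j h
  rcases lt_trichotomy i j with hij | hij | hij
  · exact (key i j hij h).elim
  · exact hij
  · exact (key j i hij h.symm).elim

/-- (The `SU₃(q)` case.) If `char F = p ≥ 5`, `q` is a power of `p`, and `t₁ ∈ F^×` has
multiplicative order `q + 1`, then with `t = diag(t₁, 1, t₁⁻¹)` the endomorphism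
`h : X ↦ -((n_w t) X (n_w t)⁻¹)ᵀ` of `sl₃(F)` has simple spectrum, i.e. eight pairwise
distinct eigenvalues. -/
theorem stmt_8 (F : Type*) [Field F] [IsAlgClosed F]
    (p : ℕ) [CharP F p] (hp : p.Prime) (hp5 : 5 ≤ p)
    (q : ℕ) (m : ℕ) (hm : 0 < m) (hq : q = p ^ m)
    (t₁ : F) (ht₁ : orderOf t₁ = q + 1)
    (hinv : ∀ X ∈ sl3 F, hFull F t₁ 1 t₁⁻¹ X ∈ sl3 F) :
    HasSimpleSpectrum ((hFull F t₁ 1 t₁⁻¹).restrict hinv) := by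
  subst hq
  have hq5 : 5 ≤ p ^ m := hp5.trans (Nat.le_self_pow hm.ne' p)
  have hpow : ∀ n, 0 < n → n < 6 → t₁ ^ n ≠ 1 := fun n h0 h6 =>
    pow_ne_one_of_lt_orderOf h0.ne' (by omega)
  have h2 : (2 : F) ≠ 0 := by
    intro h
    have hdvd : p ∣ 2 := (CharP.cast_eq_zero_iff F p 2).1 (by exact_mod_cast h)
    have := Nat.le_of_dvd two_pos hdvd
    omega
  have ht0 : t₁ ≠ 0 := by
    rintro rfl
    rw [orderOf_zero] at ht₁
    omega
  obtain ⟨s, rfl⟩ : ∃ s, t₁ = s ^ 2 := by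
    obtain ⟨s, hs⟩ := IsAlgClosed.exists_pow_nat_eq t₁ two_pos
    exact ⟨s, hs.symm⟩
  have hs : s ≠ 0 := ne_zero_pow two_ne_zero ht0
  refine hasSimpleSpectrum_of_injective_eigenvalues _ (hEigenvalue s)
    (fun i => ⟨hEigenvector s i, hEigenvector_mem_sl3 s i⟩)
    (hEigenvalue_injective hs h2 (hpow 2 (by norm_num) (by norm_num))
      (hpow 3 (by norm_num) (by norm_num))) (fun i h => ?_) (fun i => ?_) ?_
  · exact hEigenvector_ne_zero s i (congrArg Subtype.val h)
  · exact Subtype.ext (hFull_hEigenvector hs i)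
  · rw [finrank_sl3, Fintype.card_fin]
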